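/- Let p₂ > 3 be a prime and let p₃ be a prime with p₃ > 3p₂ and p₃ ≡ 2 (mod 3p₂); set q₃ = (p₃ − 2)/(3p₂). For every i with p₂ ≤ i ≤ φ(3p₂) − 1 = 2p₂ − 3, one has hw(f_{3p₂,p₃,i,q₃}) = 0; that is, the coefficients of x^{i·p₃ + 3p₂·q₃} and of x^{i·p₃ + 3p₂·q₃ + 1} in Φ_{3p₂·p₃} are both zero. -/

import Mathlib

open Polynomial

/-- The Hamming weight of a polynomial: its number of nonzero coefficients. -/
noncomputable def hw (f : Polynomial ℤ) : ℕ := f.support.card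

/-- The last block `f_{3p₂,p₃,i,q₃}`: the polynomial of degree `< 2` whose coefficient of
`x^k` is the coefficient of `x^(i*p₃ + 3*p₂*q₃ + k)` in `Φ_{3p₂p₃}`, for `k = 0, 1`. -/
noncomputable def blockQ (p₂ p₃ i q₃ : ℕ) : Polynomial ℤ :=
  ∑ k ∈ Finset.range 2,
    C ((cyclotomic (3 * p₂ * p₃) ℤ).coeff (i * p₃ + 3 * p₂ * q₃ + k)) * X ^ k

/-- The periodic coefficients of `1/Φ_3`. -/
def chi3 (n : ℕ) : ℤ := if n % 3 = 0 then 1 else if n % 3 = 1 then -1 else 0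

/-- The coefficients of `1/Φ_{3p}`. -/
def cc (p n : ℕ) : ℤ :=
  if n % (3 * p) < 3 then 1
  else if p ≤ n % (3 * p) ∧ n % (3 * p) < p + 3 then -1 else 0

lemma cyc3 : cyclotomic 3 ℤ = 1 + X + X ^ 2 := by
  rw [cyclotomic_three]; ring

lemma phi_mul (p : ℕ) (hp : p.Prime) (h3 : 3 < p) :
    cyclotomic (3 * p) ℤ * (1 + X + X ^ 2) = 1 + X ^ p + X ^ (2 * p) := by
  have hnd : ¬ p ∣ 3 := fun h => by
    have := Nat.le_of_dvd (by norm_num) h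
    omega
  have h := cyclotomic_expand_eq_cyclotomic_mul hp hnd ℤ
  rw [cyc3] at h
  rw [← h]
  simp only [map_add, map_one, map_pow, expand_X]
  ring

lemma phi_rec (p : ℕ) (hp : p.Prime) (h3 : 3 < p) (n : ℕ) :
    (cyclotomic (3 * p) ℤ).coeff n + (if 1 ≤ n then (cyclotomic (3 * p) ℤ).coeff (n - 1) else 0)
      + (if 2 ≤ n then (cyclotomic (3 * p) ℤ).coeff (n - 2) else 0)
    = (if n = 0 then 1 else 0) + (if n = p then 1 else 0) + (if n = 2 * p then 1 else 0) := by
  have h := congrArg (fun f => coeff f n) (phi_mul p hp h3)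
  simp only [mul_add, mul_one, coeff_add, coeff_X_pow, coeff_one, coeff_mul_X_pow'] at h
  rw [← h]
  congr 2
  have := coeff_mul_X_pow' (cyclotomic (3 * p) ℤ) 1 n
  rw [pow_one] at this
  exact this.symm

lemma phi_coeff (p : ℕ) (hp : p.Prime) (h3 : 3 < p) (n : ℕ) : n < 2 * p →
    (cyclotomic (3 * p) ℤ).coeff n = chi3 n + (if p ≤ n then chi3 (n - p) else 0) := by
  induction n using Nat.strong_induction_on with
  | _ n ih =>
    intro hn
    have h := phi_rec p hp h3 n
    rcases Nat.lt_or_ge n 1 with h1 | h1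
    · obtain rfl : n = 0 := by omega
      simp [chi3] at h ⊢
      split_ifs at h ⊢ <;> omega
    rcases Nat.lt_or_ge n 2 with h2 | h2
    · obtain rfl : n = 1 := by omega
      rw [ih 0 (by omega) (by omega)] at h
      simp [chi3] at h ⊢
      split_ifs at h ⊢ <;> omega
    · rw [if_pos h1, if_pos h2, ih (n - 1) (by omega) (by omega),
        ih (n - 2) (by omega) (by omega)] at h
      have e1 : chi3 n + chi3 (n - 1) + chi3 (n - 2) = 0 := by
        unfold chi3; split_ifs <;> omega
      have e2 : (if p ≤ n then chi3 (n - p) else 0) + (if p ≤ n - 1 then chi3 (n - 1 - p) else 0)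
          + (if p ≤ n - 2 then chi3 (n - 2 - p) else 0) = if n = p then 1 else 0 := by
        unfold chi3; split_ifs <;> omega
      rw [if_neg (by omega : ¬ n = 0), if_neg (by omega : ¬ n = 2 * p)] at h
      linarith

lemma cc_series (p : ℕ) (h3 : 3 < p) :
    (PowerSeries.mk (cc p)) * (1 - PowerSeries.X ^ (3 * p))
      = (((1 + X + X ^ 2) * (1 - X ^ p) : ℤ[X]) : PowerSeries ℤ) := by
  ext n
  have e : ((1 + X + X ^ 2) * (1 - X ^ p) : ℤ[X])
      = X ^ 0 + X ^ 1 + X ^ 2 - X ^ p - X ^ (p + 1) - X ^ (p + 2) := by ring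
  rw [e, mul_sub, mul_one, map_sub, PowerSeries.coeff_mul_X_pow', Polynomial.coeff_coe]
  simp only [coeff_sub, coeff_add, coeff_X_pow, PowerSeries.coeff_mk]
  by_cases h : 3 * p ≤ n
  · have : cc p n = cc p (n - 3 * p) := by
      unfold cc
      rw [← Nat.mod_eq_sub_mod h]
    rw [if_pos h, this]
    split_ifs <;> omega
  · rw [if_neg h]
    unfold cc
    rw [Nat.mod_eq_of_lt (by omega)]
    split_ifs <;> omega

lemma main_series (p r : ℕ) (hp : p.Prime) (h3 : 3 < p) (hr : r.Prime) (hgt : 3 * p < r) :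
    ((cyclotomic (3 * p * r) ℤ : ℤ[X]) : PowerSeries ℤ)
      = ((expand ℤ r (cyclotomic (3 * p) ℤ) : ℤ[X]) : PowerSeries ℤ) * PowerSeries.mk (cc p) := by
  have hnd : ¬ r ∣ 3 * p := fun h => by
    have := Nat.le_of_dvd (by omega) h
    omega
  have h := cyclotomic_expand_eq_cyclotomic_mul hr hnd ℤ
  have hne : (1 - PowerSeries.X ^ (3 * p) : PowerSeries ℤ) ≠ 0 := by
    intro h0
    have := congrArg (PowerSeries.coeff 0) h0
    rw [map_sub, PowerSeries.coeff_X_pow, if_neg (by omega)] at this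
    simp at this
  apply mul_right_cancel₀ hne
  rw [mul_assoc (Polynomial.toPowerSeries _), cc_series p h3, h]
  have e : (1 - PowerSeries.X ^ (3 * p) : PowerSeries ℤ) = ((1 - X ^ (3 * p) : ℤ[X]) : PowerSeries ℤ) := by
    simp
  rw [e, ← Polynomial.coe_mul, ← Polynomial.coe_mul]
  congr 1
  have := phi_mul p hp h3
  linear_combination (-(cyclotomic (3 * p * r) ℤ) * (1 - X ^ p)) * this

lemma main_coeff (p r : ℕ) (hp : p.Prime) (h3 : 3 < p) (hr : r.Prime) (hgt : 3 * p < r) (N : ℕ) :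
    (cyclotomic (3 * p * r) ℤ).coeff N = ∑ j ∈ Finset.range (2 * p),
      (cyclotomic (3 * p) ℤ).coeff j * (if j * r ≤ N then cc p (N - j * r) else 0) := by
  have hdeg : (cyclotomic (3 * p) ℤ).natDegree < 2 * p := by
    rw [natDegree_cyclotomic, Nat.totient_mul_of_prime_of_not_dvd Nat.prime_three, Nat.totient_prime hp]
    · omega
    · intro h
      have := (Nat.prime_dvd_prime_iff_eq Nat.prime_three hp).1 h
      omega
  rw [← Polynomial.coeff_coe, main_series p r hp h3 hr hgt]
  have e : expand ℤ r (cyclotomic (3 * p) ℤ)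
      = ∑ j ∈ Finset.range (2 * p), C ((cyclotomic (3 * p) ℤ).coeff j) * X ^ (j * r) := by
    conv_lhs => rw [as_sum_range' (cyclotomic (3 * p) ℤ) (2 * p) hdeg]
    rw [map_sum]
    refine Finset.sum_congr rfl fun j _ => ?_
    rw [expand_monomial, C_mul_X_pow_eq_monomial]
  have e2 : ((expand ℤ r (cyclotomic (3 * p) ℤ) : ℤ[X]) : PowerSeries ℤ)
      = ∑ j ∈ Finset.range (2 * p),
        PowerSeries.C ((cyclotomic (3 * p) ℤ).coeff j) * PowerSeries.X ^ (j * r) := by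
    rw [e, ← Polynomial.coeToPowerSeries.ringHom_apply, map_sum]
    refine Finset.sum_congr rfl fun j _ => ?_
    rw [Polynomial.coeToPowerSeries.ringHom_apply, Polynomial.coe_mul, Polynomial.coe_C,
      Polynomial.coe_pow, Polynomial.coe_X]
  rw [e2, Finset.sum_mul, map_sum]
  refine Finset.sum_congr rfl fun j _ => ?_
  rw [mul_assoc, PowerSeries.coeff_C_mul, PowerSeries.coeff_X_pow_mul']
  simp

lemma block_coeff (p r q : ℕ) (hp : p.Prime) (h3 : 3 < p) (hr : r.Prime) (hgt : 3 * p < r)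
    (hq : 3 * p * q + 2 = r) (i k : ℕ) (hk : k < 2) :
    (cyclotomic (3 * p * r) ℤ).coeff (i * r + 3 * p * q + k) = ∑ j ∈ Finset.range (2 * p),
      (cyclotomic (3 * p) ℤ).coeff j * (if j ≤ i then cc p (2 * (i - j) + k) else 0) := by
  rw [main_coeff p r hp h3 hr hgt]
  refine Finset.sum_congr rfl fun j _ => ?_
  congr 1
  by_cases h : j ≤ i
  · obtain ⟨s, rfl⟩ := Nat.exists_eq_add_of_le h
    have e : (j + s) * r + 3 * p * q + k = j * r + (2 * s + k + 3 * p * (s * q + q)) := by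
      rw [← hq]; ring
    rw [if_pos h, e, if_pos (by omega), Nat.add_sub_cancel_left, Nat.add_sub_cancel_left]
    unfold cc
    rw [Nat.add_mul_mod_self_left]
  · rw [if_neg h, if_neg]
    have : (i + 1) * r ≤ j * r := Nat.mul_le_mul_right r (by omega)
    rw [add_mul, one_mul] at this
    omega

lemma sum_ind (a : ℕ → ℤ) (M i d : ℕ) (hi : i < M) :
    ∑ j ∈ Finset.range M, a j * (if j + d = i then 1 else 0) = if d ≤ i then a (i - d) else 0 := by
  by_cases h : d ≤ i
  · rw [if_pos h, Finset.sum_eq_single (i - d)]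
    · rw [if_pos (by omega), mul_one]
    · intro j _ hj
      rw [if_neg (by omega), mul_zero]
    · intro hj
      exact absurd (Finset.mem_range.2 (by omega)) hj
  · rw [if_neg h]
    refine Finset.sum_eq_zero fun j _ => ?_
    rw [if_neg (by omega), mul_zero]

lemma cc_zero (h i j : ℕ) (h3 : 2 ≤ h) (hi : i ≤ 4 * h - 1) :
    (if j ≤ i then cc (2 * h + 1) (2 * (i - j) + 0) else 0) =
      (if j + 0 = i then 1 else 0) + (if j + 1 = i then 1 else 0)
      - (if j + (h + 1) = i then 1 else 0) + (if j + (3 * h + 2) = i then 1 else 0) := by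
  by_cases hj : j ≤ i
  · obtain ⟨s, rfl⟩ := Nat.exists_eq_add_of_le hj
    rw [if_pos hj, Nat.add_sub_cancel_left]
    unfold cc
    rcases Nat.lt_or_ge (2 * s) (3 * (2 * h + 1)) with hs | hs
    · rw [Nat.mod_eq_of_lt (by omega)]
      split_ifs <;> omega
    · rw [Nat.mod_eq_sub_mod (by omega), Nat.mod_eq_of_lt (by omega)]
      split_ifs <;> omega
  · rw [if_neg hj]
    split_ifs <;> omega

lemma cc_one (h i j : ℕ) (h3 : 2 ≤ h) (hi : i ≤ 4 * h - 1) :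
    (if j ≤ i then cc (2 * h + 1) (2 * (i - j) + 1) else 0) =
      (if j + 0 = i then 1 else 0) - (if j + h = i then 1 else 0)
      - (if j + (h + 1) = i then 1 else 0) + (if j + (3 * h + 1) = i then 1 else 0)
      + (if j + (3 * h + 2) = i then 1 else 0) := by
  by_cases hj : j ≤ i
  · obtain ⟨s, rfl⟩ := Nat.exists_eq_add_of_le hj
    rw [if_pos hj, Nat.add_sub_cancel_left]
    unfold cc
    rcases Nat.lt_or_ge (2 * s + 1) (3 * (2 * h + 1)) with hs | hs
    · rw [Nat.mod_eq_of_lt (by omega)]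
      split_ifs <;> omega
    · rw [Nat.mod_eq_sub_mod (by omega), Nat.mod_eq_of_lt (by omega)]
      split_ifs <;> omega
  · rw [if_neg hj]
    split_ifs <;> omega

lemma chi3_triple (a b c : ℕ) (h1 : a % 3 ≠ b % 3) (h2 : a % 3 ≠ c % 3) (h3 : b % 3 ≠ c % 3) :
    chi3 a + chi3 b + chi3 c = 0 := by
  unfold chi3; split_ifs <;> omega

lemma coeffs_zero (p r q : ℕ) (hp : p.Prime) (h3 : 3 < p) (hr : r.Prime) (hgt : 3 * p < r)
    (hq : 3 * p * q + 2 = r) (i : ℕ) (hi1 : p ≤ i) (hi2 : i ≤ 2 * p - 3) :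
    (cyclotomic (3 * p * r) ℤ).coeff (i * r + 3 * p * q + 0) = 0 ∧
    (cyclotomic (3 * p * r) ℤ).coeff (i * r + 3 * p * q + 1) = 0 := by
  have hp3 : p % 3 ≠ 0 := by
    intro h
    have := (Nat.prime_dvd_prime_iff_eq Nat.prime_three hp).1 (Nat.dvd_of_mod_eq_zero h)
    omega
  obtain ⟨h, hh⟩ : ∃ h, p = 2 * h + 1 := hp.odd_of_ne_two (by omega)
  have A := phi_coeff p hp h3
  rw [block_coeff p r q hp h3 hr hgt hq i 0 (by omega),
    block_coeff p r q hp h3 hr hgt hq i 1 (by omega)]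
  subst hh
  generalize (cyclotomic (3 * (2 * h + 1)) ℤ).coeff = a at A
  obtain ⟨M, hM⟩ : ∃ M, M = 2 * (2 * h + 1) := ⟨_, rfl⟩
  rw [← hM]
  have S := fun d => sum_ind a M i d (by omega)
  have c1 := chi3_triple (i + 1) (i - (2 * h + 1) + 1) (i - (h + 1)) (by omega) (by omega) (by omega)
  have c2 := chi3_triple i (i - (2 * h + 1)) (i + 2 * h + 1) (by omega) (by omega) (by omega)
  have c3 := chi3_triple (i - h) (i - (h + 1)) (i + 2 * h + 1) (by omega) (by omega) (by omega)
  have c4 : chi3 i + chi3 (i - 1) + chi3 (i + 1) = 0 :=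
    chi3_triple _ _ _ (by omega) (by omega) (by omega)
  have c5 : chi3 (i - (2 * h + 1)) + (if 2 * h + 1 ≤ i - 1 then chi3 (i - 1 - (2 * h + 1)) else 0)
      + chi3 (i - (2 * h + 1) + 1) = 0 := by
    unfold chi3; split_ifs <;> omega
  have A0 := A i (by omega)
  have A1 := A (i - 1) (by omega)
  have A2 := A (i - (h + 1)) (by omega)
  have A3 := A (i - h) (by omega)
  have A4 : (if 3 * h + 2 ≤ i then a (i - (3 * h + 2)) else 0)
      = if 2 * h + 1 ≤ i - (h + 1) then chi3 (i - (h + 1) - (2 * h + 1)) else 0 := by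
    by_cases hc : 3 * h + 2 ≤ i
    · rw [if_pos hc, if_pos (by omega), A _ (by omega), if_neg (by omega), add_zero]
      congr 1; omega
    · rw [if_neg hc, if_neg (by omega)]
  have A5 : (if 3 * h + 1 ≤ i then a (i - (3 * h + 1)) else 0)
      = if 2 * h + 1 ≤ i - h then chi3 (i - h - (2 * h + 1)) else 0 := by
    by_cases hc : 3 * h + 1 ≤ i
    · rw [if_pos hc, if_pos (by omega), A _ (by omega), if_neg (by omega), add_zero]
      congr 1; omega
    · rw [if_neg hc, if_neg (by omega)]
  rw [if_pos hi1] at A0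
  constructor
  · rw [Finset.sum_congr rfl fun j _ => by rw [cc_zero h i j (by omega) (by omega)]]
    simp_rw [mul_add, mul_sub, mul_add, Finset.sum_add_distrib, Finset.sum_sub_distrib,
      Finset.sum_add_distrib]
    rw [S 0, S 1, S (h + 1), S (3 * h + 2), A4, if_pos (by omega), if_pos (by omega),
      if_pos (by omega), Nat.sub_zero, A0, A1, A2]
    linarith
  · rw [Finset.sum_congr rfl fun j _ => by rw [cc_one h i j (by omega) (by omega)]]
    simp_rw [mul_add, mul_sub, Finset.sum_add_distrib, Finset.sum_sub_distrib]
    rw [S 0, S h, S (h + 1), S (3 * h + 1), S (3 * h + 2), A4, A5, if_pos (by omega),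
      if_pos (by omega), if_pos (by omega), Nat.sub_zero, A0, A3, A2]
    linarith

theorem stmt16 (p₂ p₃ q₃ : ℕ) (hp₂ : p₂.Prime) (h3 : 3 < p₂)
    (hp₃ : p₃.Prime) (hgt : 3 * p₂ < p₃) (hmod : p₃ % (3 * p₂) = 2)
    (hq₃ : 3 * p₂ * q₃ + 2 = p₃) :
    ∀ i : ℕ, p₂ ≤ i → i ≤ 2 * p₂ - 3 →
      hw (blockQ p₂ p₃ i q₃) = 0 ∧
      (cyclotomic (3 * p₂ * p₃) ℤ).coeff (i * p₃ + 3 * p₂ * q₃) = 0 ∧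
      (cyclotomic (3 * p₂ * p₃) ℤ).coeff (i * p₃ + 3 * p₂ * q₃ + 1) = 0 := by
  intro i hi1 hi2
  obtain ⟨h0, h1⟩ := coeffs_zero p₂ p₃ q₃ hp₂ h3 hp₃ hgt hq₃ i hi1 hi2
  refine ⟨?_, h0, h1⟩
  have : blockQ p₂ p₃ i q₃ = 0 := by
    unfold blockQ
    rw [Finset.sum_range_succ, Finset.sum_range_one, h0, h1]
    simp
  rw [this]
  simp [hw]
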